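/- arXiv:1109.0241 — 2 statements merged into one kernel-verified Lean document; each statement's English description precedes it below -/
import Mathlib

section
/- Let m ≥ 2 and ℓ ≥ 1 be integers, n = m²ℓ, u = exp(2πi/(mℓ)), and let γ be any nonzero complex number. For nonzero complex parameters t_0, …, t_{m−2}, define x ∈ ℂⁿ by x_{km+j} = u^k · t_0 t_1 ⋯ t_j for 0 ≤ j ≤ m−2 and x_{km+m−1} = γ · u^k · t_0^{−(m−1)} t_1^{−(m−2)} ⋯ t_{m−2}^{−1}, for k = 0, …, mℓ−1. Then the product of all coordinates satisfies x_0 x_1 ⋯ x_{n−1} = γ^{mℓ} · exp(iπ m(mℓ−1)), independently of the parameters t_0, …, t_{m−2}. -/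
/-- A product over `range (N * m)` splits into `N` consecutive blocks of length `m`. -/
theorem prod_range_mul_eq_prod_blocks {M : Type*} [CommMonoid M] (f : ℕ → M) (N m : ℕ) :
    ∏ a ∈ Finset.range (N * m), f a
      = ∏ k ∈ Finset.range N, ∏ j ∈ Finset.range m, f (k * m + j) := by
  induction N with
  | zero => simp
  | succ N ih => rw [Nat.succ_mul, Finset.prod_range_add, ih, Finset.prod_range_succ]

theorem prod_range_partial_prod {M : Type*} [CommMonoid M] (t : ℕ → M) (N : ℕ) :
    ∏ j ∈ Finset.range N, ∏ i ∈ Finset.range (j + 1), t i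
      = ∏ i ∈ Finset.range N, t i ^ (N - i) := by
  induction N with
  | zero => simp
  | succ N ih =>
    rw [Finset.prod_range_succ, ih, Finset.prod_range_succ _ N, Finset.prod_range_succ _ N,
      ← mul_assoc, ← Finset.prod_mul_distrib]
    congr 1
    · refine Finset.prod_congr rfl fun i hi => ?_
      rw [Nat.succ_sub (Finset.mem_range.mp hi).le, pow_succ]
    · simp

theorem prod_range_exp_two_pi_I_div_pow (N : ℕ) (hN : N ≠ 0) :
    ∏ k ∈ Finset.range N, Complex.exp (2 * Real.pi * Complex.I / N) ^ k
      = Complex.exp (Real.pi * Complex.I * ((N - 1 : ℕ) : ℂ)) := by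
  rw [Finset.prod_pow_eq_pow_sum, ← Complex.exp_nat_mul]
  congr 1
  have hsum : ((∑ k ∈ Finset.range N, k : ℕ) : ℂ) * 2 = N * ((N - 1 : ℕ) : ℂ) := by
    exact_mod_cast Finset.sum_range_id_mul_two N
  have hN' : (N : ℂ) ≠ 0 := Nat.cast_ne_zero.mpr hN
  field_simp
  linear_combination hsum

/-- For the monomial parametrization from Backelin's Lemma with an arbitrary
nonzero constant `γ`, the product of all `n = m²ℓ` coordinates equals
`γ^{mℓ} · exp(iπ m(mℓ-1))`, independently of the parameters. -/
theorem product_of_coordinates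
    (m ℓ : ℕ) (hm : 2 ≤ m) (hℓ : 1 ≤ ℓ)
    (n : ℕ) (hn : n = m ^ 2 * ℓ)
    (u : ℂ) (hu : u = Complex.exp (2 * Real.pi * Complex.I / (m * ℓ)))
    (γ : ℂ) (hγ : γ ≠ 0)
    (t : ℕ → ℂ) (ht : ∀ j < m - 1, t j ≠ 0)
    (x : ℕ → ℂ)
    (hx1 : ∀ k < m * ℓ, ∀ j < m - 1,
      x (k * m + j) = u ^ k * ∏ i ∈ Finset.range (j + 1), t i)
    (hx2 : ∀ k < m * ℓ,
      x (k * m + (m - 1)) =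
        γ * u ^ k * ∏ i ∈ Finset.range (m - 1), ((t i)⁻¹) ^ (m - 1 - i)) :
    ∏ a ∈ Finset.range n, x a
      = γ ^ (m * ℓ) * Complex.exp (Real.pi * Complex.I * ((m * (m * ℓ - 1) : ℕ) : ℂ)) := by
  have hblock : ∀ k < m * ℓ, ∏ j ∈ Finset.range m, x (k * m + j) = γ * (u ^ k) ^ m := by
    intro k hk
    obtain ⟨p, rfl⟩ : ∃ p, m = p + 1 := ⟨m - 1, by omega⟩
    simp only [Nat.add_sub_cancel] at ht hx1 hx2
    rw [Finset.prod_range_succ, hx2 k hk,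
      Finset.prod_congr rfl fun j hj => hx1 k hk j (Finset.mem_range.mp hj),
      Finset.prod_mul_distrib, Finset.prod_const, Finset.card_range, prod_range_partial_prod]
    have hcancel : (∏ i ∈ Finset.range p, t i ^ (p - i))
        * ∏ i ∈ Finset.range p, (t i)⁻¹ ^ (p - i) = 1 := by
      rw [← Finset.prod_mul_distrib]
      refine Finset.prod_eq_one fun i hi => ?_
      rw [← mul_pow, mul_inv_cancel₀ (ht i (Finset.mem_range.mp hi)), one_pow]
    linear_combination γ * (u ^ k) ^ (p + 1) * hcancel
  have hN : m * ℓ ≠ 0 := by positivity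
  rw [hn, show m ^ 2 * ℓ = m * ℓ * m by ring, prod_range_mul_eq_prod_blocks,
    Finset.prod_congr rfl fun k hk => hblock k (Finset.mem_range.mp hk),
    Finset.prod_mul_distrib, Finset.prod_const, Finset.card_range, Finset.prod_pow, hu,
    ← Nat.cast_mul, prod_range_exp_two_pi_I_div_pow _ hN, ← Complex.exp_nat_mul]
  congr 2
  push_cast
  ring
end

section
/- Let n ≥ 2 and let x ∈ ℂⁿ be a cyclic n-root. Then every coordinate x_i is nonzero, and the coordinatewise inverse point x^{−1} defined by (x^{−1})_i = x_i^{−1} for i = 0, …, n−1 is also a cyclic n-root. -/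
/-- The `d`-th polynomial of the cyclic `n`-roots system evaluated at `x`
(only the coordinates `x 0, …, x (n-1)` are used):
`f_d(x) = Σ_{i=0}^{n-1} Π_{j=0}^{d-1} x_{(i+j) mod n}`. -/
noncomputable def cyclicF (n d : ℕ) (x : ℕ → ℂ) : ℂ :=
  ∑ i ∈ Finset.range n, ∏ j ∈ Finset.range d, x ((i + j) % n)

/-- `x` is a cyclic `n`-root: `f_d(x) = 0` for `d = 1, …, n-1` and
`x_0 x_1 ⋯ x_{n-1} = 1`. -/
def IsCyclicRoot (n : ℕ) (x : ℕ → ℂ) : Prop :=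
  (∀ d : ℕ, 1 ≤ d → d ≤ n - 1 → cyclicF n d x = 0) ∧
  ∏ i ∈ Finset.range n, x i = 1

/-- A product over a full period of a periodic function is invariant under shifts. -/
theorem Function.Periodic.prod_range_add {M : Type*} [CommMonoid M] {g : ℕ → M} {n : ℕ}
    (hg : Function.Periodic g n) (a : ℕ) :
    ∏ i ∈ Finset.range n, g (a + i) = ∏ i ∈ Finset.range n, g i := by
  induction a with
  | zero => simp
  | succ a ih =>
    rw [← ih]
    have hshift : g (a + n) = g (a + 0) := hg a
    cases n with
    | zero => simp
    | succ m =>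
      rw [Finset.prod_range_succ, Finset.prod_range_succ' (fun i => g (a + i)), ← hshift]
      simp only [add_assoc, add_comm 1]

/-- A sum over a full period of a periodic function is invariant under shifts. -/
theorem Function.Periodic.sum_range_add {M : Type*} [AddCommMonoid M] {g : ℕ → M} {n : ℕ}
    (hg : Function.Periodic g n) (a : ℕ) :
    ∑ i ∈ Finset.range n, g (a + i) = ∑ i ∈ Finset.range n, g i :=
  Function.Periodic.prod_range_add (M := Multiplicative M) hg a

/-- If the coordinates multiply to `1`, then inverting them turns `f_d` into `f_{n-d}`. -/
theorem cyclicF_inv {n d : ℕ} {x : ℕ → ℂ} (hd : d ≤ n)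
    (hprod : ∏ i ∈ Finset.range n, x i = 1) :
    cyclicF n d (fun i => (x i)⁻¹) = cyclicF n (n - d) x := by
  have hper : Function.Periodic (fun i => x (i % n)) n := fun i => by simp
  have hfull (i : ℕ) : ∏ j ∈ Finset.range n, x ((i + j) % n) = 1 := by
    rw [hper.prod_range_add i, ← hprod]
    exact Finset.prod_congr rfl fun j hj => by rw [Nat.mod_eq_of_lt (Finset.mem_range.mp hj)]
  have hblock : Function.Periodic
      (fun i => ∏ j ∈ Finset.range (n - d), x ((i + j) % n)) n := fun i =>
    Finset.prod_congr rfl fun j _ => by rw [add_right_comm, Nat.add_mod_right]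
  unfold cyclicF
  rw [← hblock.sum_range_add d]
  refine Finset.sum_congr rfl fun i _ => ?_
  rw [Finset.prod_inv_distrib]
  refine inv_eq_of_mul_eq_one_right ?_
  rw [← hfull i]
  conv_rhs => rw [← Nat.add_sub_cancel' hd, Finset.prod_range_add, Nat.add_sub_cancel' hd]
  simp only [add_assoc, add_left_comm]

/-- Every coordinate of a cyclic `n`-root is nonzero, and the coordinatewise
inverse of a cyclic `n`-root is again a cyclic `n`-root. -/
theorem cyclicRoot_inv (n : ℕ) (hn : 2 ≤ n) (x : ℕ → ℂ)
    (hx : IsCyclicRoot n x) :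
    (∀ i < n, x i ≠ 0) ∧ IsCyclicRoot n (fun i => (x i)⁻¹) := by
  obtain ⟨hzero, hprod⟩ := hx
  refine ⟨fun i hi => ?_, fun d hd hdn => ?_, ?_⟩
  · refine Finset.prod_ne_zero_iff.mp ?_ i (Finset.mem_range.mpr hi)
    rw [hprod]
    exact one_ne_zero
  · rw [cyclicF_inv (by omega) hprod]
    exact hzero (n - d) (by omega) (by omega)
  · rw [Finset.prod_inv_distrib, hprod, inv_one]
end
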